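/- There exists a universal constant A > 0 such that for every probability measure μ on ℝ with infinite support and all moments finite, every bounded measurable f : ℝ → ℝ, every n ∈ ℕ and every ε > 0, the OPE of size n associated with μ satisfies: P(|X_f^{(n)} − E[X_f^{(n)}]| ≥ ε) ≤ 2·exp(−ε²/(4A · Var X_f^{(n)})) if ε < 2A·Var X_f^{(n)}/(3‖f‖_∞), and P(|X_f^{(n)} − E[X_f^{(n)}]| ≥ ε) ≤ 2·exp(−ε/(6‖f‖_∞)) if ε ≥ 2A·Var X_f^{(n)}/(3‖f‖_∞). -/

import Mathlib

open MeasureTheory ProbabilityTheory Filter Topology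

noncomputable section

/-- The squared Vandermonde determinant `∏_{i>j} (λ_i - λ_j)^2`. -/
def vandSq {n : ℕ} (l : Fin n → ℝ) : ℝ :=
  ∏ q ∈ Finset.univ.filter (fun q : Fin n × Fin n => q.2 < q.1), (l q.1 - l q.2) ^ 2

/-- The orthogonal polynomial ensemble of size `n` associated with `μ`: the probability
measure on `ℝ^n` proportional to `∏_{i>j}(λ_i-λ_j)^2 dμ(λ_1)⋯dμ(λ_n)`. -/
def OPE (μ : Measure ℝ) (n : ℕ) : Measure (Fin n → ℝ) :=
  ((((Measure.pi fun _ : Fin n => μ).withDensity fun l => ENNReal.ofReal (vandSq l))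
    Set.univ)⁻¹) •
    ((Measure.pi fun _ : Fin n => μ).withDensity fun l => ENNReal.ofReal (vandSq l))

/-- The linear statistic `X_f = ∑ f(λ_j)`. -/
def linStat {n : ℕ} (f : ℝ → ℝ) (l : Fin n → ℝ) : ℝ := ∑ j, f (l j)

/-- The scaled linear statistic `X_{f,α,x*} = ∑ f(n^α (λ_j - x*))`. -/
def scaledLinStat {n : ℕ} (f : ℝ → ℝ) (α xs : ℝ) (l : Fin n → ℝ) : ℝ :=
  ∑ j, f ((n : ℝ) ^ α * (l j - xs))

/-- `p` is the family of orthonormal polynomials of `μ`: `p j` has degree `j`, positive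
leading coefficient, and `∫ p_i p_j dμ = δ_{ij}`. -/
def IsOrthonormalPolys (μ : Measure ℝ) (p : ℕ → Polynomial ℝ) : Prop :=
  (∀ j, (p j).degree = (j : WithBot ℕ)) ∧ (∀ j, 0 < (p j).leadingCoeff) ∧
    ∀ i j, ∫ x, (p i).eval x * (p j).eval x ∂μ = if i = j then 1 else 0

/-- All moments of `μ` are finite. -/
def HasAllMoments (μ : Measure ℝ) : Prop := ∀ k : ℕ, Integrable (fun x : ℝ => x ^ k) μ

/-- `μ` has infinite support: no finite set carries full `μ`-measure. -/
def InfiniteSupport (μ : Measure ℝ) : Prop := ∀ s : Finset ℝ, μ ((↑s : Set ℝ)ᶜ) ≠ 0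

/-- The Christoffel–Darboux kernel `K_n(x,y) = ∑_{j<n} p_j(x) p_j(y)`. -/
def CDKernel (p : ℕ → Polynomial ℝ) (n : ℕ) (x y : ℝ) : ℝ :=
  ∑ j ∈ Finset.range n, (p j).eval x * (p j).eval y

/-- The sup norm `‖f‖_∞` of a (bounded) function. -/
def supNorm (f : ℝ → ℝ) : ℝ := ⨆ x, |f x|

/-- The (topological) support of a measure on `ℝ`. -/
def measSupport (μ : Measure ℝ) : Set ℝ := {x | ∀ U ∈ 𝓝 x, μ U ≠ 0}

/-- The sine kernel `sin(πt)/(πt)` (equal to `1` at `t = 0`). -/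
def sineKernel (t : ℝ) : ℝ := if t = 0 then 1 else Real.sin (Real.pi * t) / (Real.pi * t)

/-- `K̃_n(x,y) = w(x)^{1/2} w(y)^{1/2} K_n(x,y)`, where `w` is the Radon–Nikodym
derivative of `μ` with respect to Lebesgue measure. -/
def tildeK (μ : Measure ℝ) (Kf : ℝ → ℝ → ℝ) (x y : ℝ) : ℝ :=
  Real.sqrt ((μ.rnDeriv volume x).toReal) * Real.sqrt ((μ.rnDeriv volume y).toReal) * Kf x y

/-- The Nevai condition at `x*` for a sequence of measures with kernels `Kf n`. -/
def NevaiCond (μ : ℕ → Measure ℝ) (Kf : ℕ → ℝ → ℝ → ℝ) (xs : ℝ) : Prop :=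
  ∀ f : ℝ → ℝ, Continuous f → HasCompactSupport f →
    Tendsto (fun n => ∫ y, (f y - f xs) * Kf n xs y ^ 2 / Kf n xs xs ∂(μ n)) atTop (𝓝 0)

/-- The `α`-Nevai condition at `x*` for a sequence of measures with kernels `Kf n`. -/
def AlphaNevaiCond (μ : ℕ → Measure ℝ) (Kf : ℕ → ℝ → ℝ → ℝ) (α xs : ℝ) : Prop :=
  ∀ f : ℝ → ℝ, Continuous f → HasCompactSupport f →
    ∀ S : Set ℝ, IsCompact S →
      TendstoUniformlyOn
        (fun n s => ∫ y, (f s - f ((n : ℝ) ^ α * (y - xs))) *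
            Kf n (xs + s / (n : ℝ) ^ α) y ^ 2 /
            Kf n (xs + s / (n : ℝ) ^ α) (xs + s / (n : ℝ) ^ α) ∂(μ n))
        (fun _ => 0) atTop S

open Matrix in
/-- The determinant of a positive semidefinite matrix `N` is at most `exp (tr (N - 1))`. -/
theorem Matrix.PosSemidef.det_le_exp_trace_sub_card {n : ℕ} {N : Matrix (Fin n) (Fin n) ℝ}
    (hN : N.PosSemidef) : N.det ≤ Real.exp (N.trace - n) := by
  rw [hN.1.det_eq_prod_eigenvalues, hN.1.trace_eq_sum_eigenvalues]
  have h : ∀ i, hN.1.eigenvalues i ≤ Real.exp (hN.1.eigenvalues i - 1) := fun i => by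
    linarith [Real.add_one_le_exp (hN.1.eigenvalues i - 1)]
  calc (∏ i, (hN.1.eigenvalues i : ℝ)) ≤ ∏ i, Real.exp (hN.1.eigenvalues i - 1) :=
        Finset.prod_le_prod (fun i _ => hN.eigenvalues_nonneg i) fun i _ => h i
    _ = _ := by rw [← Real.exp_sum]; simp

open Matrix in
/-- A positive definite and a symmetric real matrix can be diagonalised by one congruence. -/
theorem exists_simultaneous_diagonalization {n : ℕ} {G F : Matrix (Fin n) (Fin n) ℝ}
    (hG : G.PosDef) (hF : F.IsHermitian) :
    ∃ (R : Matrix (Fin n) (Fin n) ℝ) (b : Fin n → ℝ),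
      R.det ≠ 0 ∧ R * G * Rᵀ = 1 ∧ R * F * Rᵀ = diagonal b := by
  let U : Matrix (Fin n) (Fin n) ℝ := hG.1.eigenvectorUnitary
  let d : Fin n → ℝ := hG.1.eigenvalues
  have hd : ∀ i, 0 < d i := hG.eigenvalues_pos
  have hU : star U * U = 1 := Unitary.coe_star_mul_self hG.1.eigenvectorUnitary
  have hGU : G = U * diagonal d * star U := by
    have := hG.1.spectral_theorem
    rwa [Unitary.conjStarAlgAut_apply] at this
  let T : Matrix (Fin n) (Fin n) ℝ := diagonal (fun i => (√(d i))⁻¹) * Uᵀ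
  have hs : ∀ M : Matrix (Fin n) (Fin n) ℝ, star M = Mᵀ := fun M => by
    rw [star_eq_conjTranspose, conjTranspose_eq_transpose_of_trivial]
  rw [hs] at hU hGU
  have hT : T * G * Tᵀ = 1 := by
    have e : T * G * Tᵀ = diagonal (fun i => (√(d i))⁻¹) * (Uᵀ * U) * diagonal d * (Uᵀ * U) *
        diagonal (fun i => (√(d i))⁻¹) := by
      conv_lhs => rw [hGU]
      simp only [T, transpose_mul, transpose_transpose, diagonal_transpose, Matrix.mul_assoc]
    rw [e, hU, Matrix.mul_one, Matrix.mul_one, diagonal_mul_diagonal, diagonal_mul_diagonal,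
      ← diagonal_one]
    congr 1
    funext i
    have := Real.sqrt_ne_zero'.2 (hd i)
    have h2 := Real.mul_self_sqrt (hd i).le
    field_simp
    nlinarith
  have hF' : (T * F * Tᵀ).IsHermitian := by
    rw [← conjTranspose_eq_transpose_of_trivial]
    exact isHermitian_mul_mul_conjTranspose T hF
  let V : Matrix (Fin n) (Fin n) ℝ := hF'.eigenvectorUnitary
  have hV : Vᵀ * V = 1 := by
    rw [← hs]; exact Unitary.coe_star_mul_self hF'.eigenvectorUnitary
  have hFV : T * F * Tᵀ = V * diagonal hF'.eigenvalues * Vᵀ := by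
    have := hF'.spectral_theorem
    rw [Unitary.conjStarAlgAut_apply, hs] at this
    exact this
  have hR : (Vᵀ * T) * G * (Vᵀ * T)ᵀ = 1 := by
    have : (Vᵀ * T) * G * (Vᵀ * T)ᵀ = Vᵀ * (T * G * Tᵀ) * V := by
      simp only [transpose_mul, transpose_transpose, Matrix.mul_assoc]
    rw [this, hT, Matrix.mul_one, hV]
  refine ⟨Vᵀ * T, hF'.eigenvalues, fun h => ?_, hR, ?_⟩
  · have := congrArg det hR
    simp [det_mul, h] at this
  · have : (Vᵀ * T) * F * (Vᵀ * T)ᵀ = Vᵀ * (T * F * Tᵀ) * V := by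
      simp only [transpose_mul, transpose_transpose, Matrix.mul_assoc]
    rw [this]
    refine (congrArg (fun M => Vᵀ * M * V) hFV).trans ?_
    have : Vᵀ * (V * diagonal hF'.eigenvalues * Vᵀ) * V =
        (Vᵀ * V) * diagonal hF'.eigenvalues * (Vᵀ * V) := by
      simp only [Matrix.mul_assoc]
    rw [this, hV, Matrix.one_mul, Matrix.mul_one]

/-- The matrix of the bilinear form `(u, w) ↦ ∫ g u w dμ` in the family `v`. -/
def weightedGram (μ : Measure ℝ) {n : ℕ} (v : Fin n → ℝ → ℝ) (g : ℝ → ℝ) :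
    Matrix (Fin n) (Fin n) ℝ :=
  Matrix.of fun i j => ∫ x, g x * (v i x * v j x) ∂μ

/-- The Gram matrix of the monomials of degree less than `n` is positive definite. -/
theorem posDef_momentMatrix {μ : Measure ℝ} (hinf : InfiniteSupport μ) (hmom : HasAllMoments μ)
    (n : ℕ) : (weightedGram μ (fun (i : Fin n) x => x ^ (i : ℕ)) fun _ => 1).PosDef := by
  simp only [weightedGram, one_mul]
  refine Matrix.PosDef.of_dotProduct_mulVec_pos ?_ fun c hc => ?_
  · ext i j
    simp [mul_comm]
  · have hint : ∀ i j : Fin n, Integrable (fun x : ℝ => c i * (x ^ (i : ℕ) * x ^ (j : ℕ) * c j)) μ :=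
      fun i j => by
        simpa only [← pow_add] using ((hmom (i + j)).mul_const (c j)).const_mul (c i)
    have hsq : (fun x : ℝ => ∑ i : Fin n, ∑ j : Fin n, c i * (x ^ (i : ℕ) * x ^ (j : ℕ) * c j)) =
        fun x => (∑ i, c i * x ^ (i : ℕ)) ^ 2 := by
      funext x
      rw [sq, Finset.sum_mul_sum]
      exact Finset.sum_congr rfl fun i _ => Finset.sum_congr rfl fun j _ => by ring
    have hi : Integrable (fun x : ℝ => ∑ i : Fin n, ∑ j : Fin n, c i * (x ^ (i : ℕ) * x ^ (j : ℕ) * c j)) μ :=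
      integrable_finsetSum _ fun i _ => integrable_finsetSum _ fun j _ => hint i j
    have e : star c ⬝ᵥ (Matrix.of fun i j : Fin n => ∫ x, x ^ (i : ℕ) * x ^ (j : ℕ) ∂μ).mulVec c =
        ∫ x, (∑ i, c i * x ^ (i : ℕ)) ^ 2 ∂μ := by
      rw [← hsq, integral_finsetSum _ fun i _ => integrable_finsetSum _ fun j _ => hint i j]
      simp only [dotProduct, Matrix.mulVec, Matrix.of_apply, star_trivial]
      refine Finset.sum_congr rfl fun i _ => ?_
      rw [integral_finsetSum _ fun j _ => hint i j, Finset.mul_sum]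
      simp only [integral_const_mul, integral_mul_const]
    rw [e]
    refine lt_of_le_of_ne (integral_nonneg fun x => sq_nonneg _) fun h0 => ?_
    rw [hsq] at hi
    have hae := (integral_eq_zero_iff_of_nonneg (fun x => sq_nonneg _) hi).1 h0.symm
    let p : Polynomial ℝ := ∑ i : Fin n, Polynomial.C (c i) * Polynomial.X ^ (i : ℕ)
    have hp : p ≠ 0 := fun h => hc <| by
      funext i
      have := congrArg (fun q => Polynomial.coeff q i) h
      simpa [p, Polynomial.finsetSum_coeff, Polynomial.coeff_X_pow, Fin.val_inj] using this
    refine hinf p.roots.toFinset ((ae_iff (p := fun x => x ∈ (p.roots.toFinset : Set ℝ))).1 ?_)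
    filter_upwards [hae] with x hx
    have hx' : ∑ i, c i * x ^ (i : ℕ) = 0 := by simpa using hx
    simp [hp, p, Polynomial.eval_finsetSum, hx']

theorem vandSq_eq_det_sq {n : ℕ} (l : Fin n → ℝ) : vandSq l = (Matrix.vandermonde l).det ^ 2 := by
  rw [Matrix.det_vandermonde, vandSq, Finset.prod_filter, Fintype.prod_prod_type,
    Finset.prod_comm, ← Finset.prod_pow]
  refine Finset.prod_congr rfl fun i _ => ?_
  rw [← Finset.prod_pow, ← Finset.prod_filter]
  congr 1
  ext j
  simp

theorem det_sq_mul_prod_eq_sum {n : ℕ} (v : Fin n → ℝ → ℝ) (g : ℝ → ℝ) (l : Fin n → ℝ) :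
    (Matrix.of fun i j => v i (l j)).det ^ 2 * ∏ j, g (l j) =
      ∑ σ : Equiv.Perm (Fin n), ∑ τ : Equiv.Perm (Fin n),
        (((Equiv.Perm.sign σ : ℤ) : ℝ) * ((Equiv.Perm.sign τ : ℤ) : ℝ)) *
          ∏ j, (g (l j) * (v (σ j) (l j) * v (τ j) (l j))) := by
  rw [sq, Matrix.det_apply', Finset.sum_mul_sum, Finset.sum_mul]
  refine Finset.sum_congr rfl fun σ _ => ?_
  rw [Finset.sum_mul]
  refine Finset.sum_congr rfl fun τ _ => ?_
  simp only [Matrix.of_apply, Finset.prod_mul_distrib]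
  ring

/-- Integrability in Andréief's identity. -/
theorem integrable_det_sq_mul_prod {μ : Measure ℝ} [IsProbabilityMeasure μ] {n : ℕ}
    {v : Fin n → ℝ → ℝ} {g : ℝ → ℝ} (h : ∀ i j, Integrable (fun x => g x * (v i x * v j x)) μ) :
    Integrable (fun l : Fin n → ℝ =>
      (Matrix.of fun i j => v i (l j)).det ^ 2 * ∏ j, g (l j)) (Measure.pi fun _ => μ) := by
  simp_rw [det_sq_mul_prod_eq_sum]
  exact integrable_finsetSum _ fun σ _ => integrable_finsetSum _ fun τ _ =>
    (Integrable.fintype_prod fun j => h (σ j) (τ j)).const_mul _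

/-- **Andréief's identity** for a squared determinant. -/
theorem integral_det_sq_mul_prod {μ : Measure ℝ} [IsProbabilityMeasure μ] {n : ℕ}
    {v : Fin n → ℝ → ℝ} {g : ℝ → ℝ} (h : ∀ i j, Integrable (fun x => g x * (v i x * v j x)) μ) :
    ∫ l : Fin n → ℝ, (Matrix.of fun i j => v i (l j)).det ^ 2 * ∏ j, g (l j)
        ∂(Measure.pi fun _ => μ) =
      n.factorial * (weightedGram μ v g).det := by
  have hi : ∀ σ τ : Equiv.Perm (Fin n), Integrable (fun l : Fin n → ℝ =>
      (((Equiv.Perm.sign σ : ℤ) : ℝ) * ((Equiv.Perm.sign τ : ℤ) : ℝ)) *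
          ∏ j, (g (l j) * (v (σ j) (l j) * v (τ j) (l j)))) (Measure.pi fun _ => μ) :=
    fun σ τ => (Integrable.fintype_prod fun j => h (σ j) (τ j)).const_mul _
  set M := weightedGram μ v g
  simp_rw [det_sq_mul_prod_eq_sum]
  rw [integral_finsetSum _ fun σ _ => integrable_finsetSum _ fun τ _ => hi σ τ]
  have key : ∀ τ : Equiv.Perm (Fin n),
      (∑ σ : Equiv.Perm (Fin n), (((Equiv.Perm.sign σ : ℤ) : ℝ) * ((Equiv.Perm.sign τ : ℤ) : ℝ)) *
        ∏ j, M (σ j) (τ j)) = M.det := by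
    intro τ
    have h1 := Matrix.det_permute' τ M
    rw [Matrix.det_apply'] at h1
    simp only [Matrix.submatrix_apply, id] at h1
    have h2 : (((Equiv.Perm.sign τ : ℤ) : ℝ) * ((Equiv.Perm.sign τ : ℤ) : ℝ)) = 1 := by
      rw [← Int.cast_mul, Int.units_coe_mul_self, Int.cast_one]
    calc _ = ((Equiv.Perm.sign τ : ℤ) : ℝ) *
          ∑ σ : Equiv.Perm (Fin n), ((Equiv.Perm.sign σ : ℤ) : ℝ) * ∏ j, M (σ j) (τ j) := by
          rw [Finset.mul_sum]
          exact Finset.sum_congr rfl fun σ _ => by ring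
      _ = M.det := by rw [h1, ← mul_assoc, h2, one_mul]
  calc _ = ∑ σ : Equiv.Perm (Fin n), ∑ τ : Equiv.Perm (Fin n),
        (((Equiv.Perm.sign σ : ℤ) : ℝ) * ((Equiv.Perm.sign τ : ℤ) : ℝ)) *
          ∏ j, M (σ j) (τ j) := by
        refine Finset.sum_congr rfl fun σ _ => ?_
        rw [integral_finsetSum _ fun τ _ => hi σ τ]
        refine Finset.sum_congr rfl fun τ _ => ?_
        rw [integral_const_mul,
          integral_fintype_prod_eq_prod (μ := fun _ => μ)
            (fun j x => g x * (v (σ j) x * v (τ j) x))]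
        rfl
    _ = _ := by
        rw [Finset.sum_comm, Finset.sum_congr rfl fun τ _ => key τ]
        simp [Fintype.card_perm]

theorem Integrable.mul_of_abs_le {α : Type*} [MeasurableSpace α] {μ : Measure α} {g h : α → ℝ}
    {C : ℝ} (hg : Measurable g) (hC : ∀ x, |g x| ≤ C) (hh : Integrable h μ) :
    Integrable (fun x => g x * h x) μ :=
  hh.bdd_mul hg.aestronglyMeasurable (Eventually.of_forall hC)

theorem weightedGram_linear_combination {μ : Measure ℝ} {n : ℕ} {v : Fin n → ℝ → ℝ} {g : ℝ → ℝ}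
    (h : ∀ i j, Integrable (fun x => g x * (v i x * v j x)) μ) (R : Matrix (Fin n) (Fin n) ℝ) :
    weightedGram μ (fun i x => ∑ k, R i k * v k x) g = R * weightedGram μ v g * R.transpose := by
  ext i j
  have hi : ∀ k l, Integrable (fun x => R i k * (g x * (v k x * v l x)) * R j l) μ :=
    fun k l => ((h k l).const_mul _).mul_const _
  have e : (fun x => g x * ((∑ k, R i k * v k x) * ∑ l, R j l * v l x)) =
      fun x => ∑ l, ∑ k, R i k * (g x * (v k x * v l x)) * R j l := by
    funext x
    rw [Finset.sum_comm, Finset.sum_mul_sum, Finset.mul_sum]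
    refine Finset.sum_congr rfl fun k _ => ?_
    rw [Finset.mul_sum]
    exact Finset.sum_congr rfl fun l _ => by ring
  simp only [weightedGram, Matrix.of_apply, Matrix.mul_apply, Matrix.transpose_apply]
  rw [e, integral_finsetSum _ fun l _ => integrable_finsetSum _ fun k _ => hi k l]
  refine Finset.sum_congr rfl fun l _ => ?_
  rw [integral_finsetSum _ fun k _ => hi k l, Finset.sum_mul]
  simp only [integral_mul_const, integral_const_mul]

theorem posSemidef_weightedGram {μ : Measure ℝ} {n : ℕ} {v : Fin n → ℝ → ℝ} {g : ℝ → ℝ}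
    (hg : ∀ x, 0 ≤ g x) (h : ∀ i j, Integrable (fun x => g x * (v i x * v j x)) μ) :
    (weightedGram μ v g).PosSemidef := by
  refine Matrix.PosSemidef.of_dotProduct_mulVec_nonneg ?_ fun c => ?_
  · ext i j
    simp [weightedGram, mul_comm (v i _)]
  · have e : star c ⬝ᵥ (weightedGram μ v g).mulVec c = ∫ x, g x * (∑ i, c i * v i x) ^ 2 ∂μ := by
      rcases n with _ | n
      · simp
      · have := congrFun (congrFun (weightedGram_linear_combination h
          (Matrix.of fun _ k => c k)) 0) 0
        simp only [weightedGram, Matrix.of_apply, ← sq] at this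
        rw [this, Matrix.mul_assoc]
        simp [Matrix.mul_apply, dotProduct, Matrix.mulVec, weightedGram]
    rw [e]
    exact integral_nonneg fun x => mul_nonneg (hg x) (sq_nonneg _)

theorem measurable_vandSq {n : ℕ} : Measurable (vandSq (n := n)) := by
  unfold vandSq
  fun_prop

theorem vandSq_eq_det_monomials_sq {n : ℕ} (l : Fin n → ℝ) :
    vandSq l = (Matrix.of fun i j : Fin n => l j ^ (i : ℕ)).det ^ 2 := by
  rw [vandSq_eq_det_sq, ← Matrix.det_transpose]
  rfl

theorem vandSq_nonneg {n : ℕ} (l : Fin n → ℝ) : 0 ≤ vandSq l := by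
  rw [vandSq_eq_det_sq]
  positivity

theorem HasAllMoments.integrable_mul {μ : Measure ℝ} (hmom : HasAllMoments μ) {g : ℝ → ℝ} {C : ℝ}
    (hg : Measurable g) (hC : ∀ x, |g x| ≤ C) {n : ℕ} (i j : Fin n) :
    Integrable (fun x => g x * (x ^ (i : ℕ) * x ^ (j : ℕ))) μ := by
  simp_rw [← pow_add]
  exact Integrable.mul_of_abs_le hg hC (hmom _)

section OPE

variable {μ : Measure ℝ} [IsProbabilityMeasure μ]

theorem integral_vandSq_mul_prod (hmom : HasAllMoments μ) {g : ℝ → ℝ} {C : ℝ} (hg : Measurable g)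
    (hC : ∀ x, |g x| ≤ C) (n : ℕ) :
    ∫ l : Fin n → ℝ, vandSq l * ∏ j, g (l j) ∂(Measure.pi fun _ => μ) =
      n.factorial * (weightedGram μ (fun (i : Fin n) x => x ^ (i : ℕ)) g).det := by
  simp_rw [vandSq_eq_det_monomials_sq]
  exact integral_det_sq_mul_prod (v := fun (i : Fin n) x => x ^ (i : ℕ))
    (hmom.integrable_mul hg hC)

theorem withDensity_vandSq_univ (hmom : HasAllMoments μ) (n : ℕ) :
    ((Measure.pi fun _ : Fin n => μ).withDensity fun l => ENNReal.ofReal (vandSq l)) Set.univ =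
      ENNReal.ofReal (n.factorial *
        (weightedGram μ (fun (i : Fin n) x => x ^ (i : ℕ)) fun _ => 1).det) := by
  have hone : ∀ x : ℝ, |(fun _ : ℝ => (1 : ℝ)) x| ≤ 1 := by simp
  have hint : Integrable (vandSq (n := n)) (Measure.pi fun _ => μ) := by
    have := integrable_det_sq_mul_prod (v := fun (i : Fin n) x => x ^ (i : ℕ))
      (hmom.integrable_mul measurable_const hone)
    simpa only [Finset.prod_const_one, mul_one, ← vandSq_eq_det_monomials_sq] using this
  rw [withDensity_apply _ MeasurableSet.univ, Measure.restrict_univ,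
    ← ofReal_integral_eq_lintegral_ofReal hint (Eventually.of_forall vandSq_nonneg),
    ← integral_vandSq_mul_prod hmom measurable_const hone]
  simp

theorem isProbabilityMeasure_OPE (hinf : InfiniteSupport μ) (hmom : HasAllMoments μ) (n : ℕ) :
    IsProbabilityMeasure (OPE μ n) := by
  constructor
  have := (posDef_momentMatrix hinf hmom n).det_pos
  rw [OPE, Measure.smul_apply, smul_eq_mul, withDensity_vandSq_univ hmom]
  refine ENNReal.inv_mul_cancel ?_ ENNReal.ofReal_ne_top
  rw [Ne, ENNReal.ofReal_eq_zero, not_le]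
  positivity

theorem integral_prod_OPE (hinf : InfiniteSupport μ) (hmom : HasAllMoments μ) {g : ℝ → ℝ} {C : ℝ}
    (hg : Measurable g) (hC : ∀ x, |g x| ≤ C) (n : ℕ) :
    ∫ l, ∏ j, g (l j) ∂(OPE μ n) =
      (weightedGram μ (fun (i : Fin n) x => x ^ (i : ℕ)) g).det /
        (weightedGram μ (fun (i : Fin n) x => x ^ (i : ℕ)) fun _ => 1).det := by
  have hpos := (posDef_momentMatrix hinf hmom n).det_pos
  rw [OPE, integral_smul_measure, withDensity_vandSq_univ hmom,
    integral_withDensity_eq_integral_toReal_smul (measurable_vandSq.ennreal_ofReal)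
      (Eventually.of_forall fun _ => ENNReal.ofReal_lt_top)]
  simp_rw [ENNReal.toReal_ofReal (vandSq_nonneg _), smul_eq_mul]
  rw [integral_vandSq_mul_prod hmom hg hC, ENNReal.toReal_inv, ENNReal.toReal_ofReal (by positivity)]
  have : (n.factorial : ℝ) ≠ 0 := by positivity
  field_simp

/-- For bounded `f` there are functions `v` (orthonormal polynomials of degree less than `n` that
diagonalise multiplication by `f`) in which the ensemble average of every product `∏ g (l j)` is
the determinant of the matrix of multiplication by `g`. -/
theorem exists_diagonalizing_family (hinf : InfiniteSupport μ) (hmom : HasAllMoments μ)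
    {f : ℝ → ℝ} {C : ℝ} (hf : Measurable f) (hC : ∀ x, |f x| ≤ C) (n : ℕ) :
    ∃ (v : Fin n → ℝ → ℝ) (b : Fin n → ℝ),
      (∀ i j, Integrable (fun x => v i x * v j x) μ) ∧
      weightedGram μ v (fun _ => 1) = 1 ∧ weightedGram μ v f = Matrix.diagonal b ∧
      ∀ (g : ℝ → ℝ) (K : ℝ), Measurable g → (∀ x, |g x| ≤ K) →
        ∫ l, ∏ j, g (l j) ∂(OPE μ n) = (weightedGram μ v g).det := by
  have hone : ∀ x : ℝ, |(fun _ : ℝ => (1 : ℝ)) x| ≤ 1 := by simp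
  have hG := posDef_momentMatrix hinf hmom n
  have hF : (weightedGram μ (fun (i : Fin n) x => x ^ (i : ℕ)) f).IsHermitian := by
    ext i j
    simp [weightedGram, mul_comm]
  obtain ⟨R, b, hR, h1, h2⟩ := exists_simultaneous_diagonalization hG hF
  refine ⟨fun i x => ∑ k, R i k * x ^ (k : ℕ), b, fun i j => ?_, ?_, ?_, fun g K hg hK => ?_⟩
  · simp_rw [Finset.sum_mul_sum]
    refine integrable_finsetSum _ fun k _ => integrable_finsetSum _ fun l _ => ?_
    have := (hmom (k + l)).const_mul (R i k * R j l)
    refine this.congr (Eventually.of_forall fun x => ?_)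
    simp only [pow_add]
    ring
  · rw [weightedGram_linear_combination (hmom.integrable_mul measurable_const hone), h1]
  · rw [weightedGram_linear_combination (hmom.integrable_mul hf hC), h2]
  · rw [weightedGram_linear_combination (hmom.integrable_mul hg hK),
      integral_prod_OPE hinf hmom hg hK, div_eq_iff hG.det_pos.ne']
    have := congrArg Matrix.det h1
    simp only [Matrix.det_mul, Matrix.det_transpose, Matrix.det_one] at this ⊢
    linear_combination (-(weightedGram μ (fun (i : Fin n) x => x ^ (i : ℕ)) g).det) * this

end OPE

open Polynomial in
theorem coeff_prod_one_add_C_mul_X {ι : Type*} (s : Finset ι) (a : ι → ℝ) :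
    (∏ j ∈ s, (1 + C (a j) * X)).coeff 0 = 1 ∧
    (∏ j ∈ s, (1 + C (a j) * X)).coeff 1 = ∑ j ∈ s, a j ∧
    2 * (∏ j ∈ s, (1 + C (a j) * X)).coeff 2 = (∑ j ∈ s, a j) ^ 2 - ∑ j ∈ s, a j ^ 2 := by
  classical
  induction s using Finset.induction_on with
  | empty => simp [coeff_one]
  | insert i s hi ih =>
    obtain ⟨h0, h1, h2⟩ := ih
    rw [Finset.prod_insert hi, Finset.sum_insert hi, Finset.sum_insert hi]
    simp only [add_mul, one_mul, coeff_add, mul_assoc, coeff_C_mul, coeff_X_mul_zero, h0, h1,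
      coeff_X_mul _ 0, coeff_X_mul _ 1]
    refine ⟨by ring, by ring, ?_⟩
    rw [mul_add, h2]
    ring

theorem integrable_of_measurable_of_abs_le {α : Type*} [MeasurableSpace α] {P : Measure α}
    [IsFiniteMeasure P] {h : α → ℝ} {K : ℝ} (hm : Measurable h) (hK : ∀ x, |h x| ≤ K) :
    Integrable h P :=
  Integrable.of_bound hm.aestronglyMeasurable K (Eventually.of_forall hK)

open Polynomial in
theorem coeff_prod_measurable_bounded {ι α : Type*} [MeasurableSpace α] (s : Finset ι)
    {h : ι → α → ℝ} {K : ℝ} (hm : ∀ i, Measurable (h i)) (hK : ∀ i x, |h i x| ≤ K) :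
    ∀ k, Measurable (fun x => (∏ j ∈ s, (1 + C (h j x) * X)).coeff k) ∧
      ∃ B, ∀ x, |(∏ j ∈ s, (1 + C (h j x) * X)).coeff k| ≤ B := by
  classical
  induction s using Finset.induction_on with
  | empty => exact fun k => ⟨by simp, _, fun x => by simpa using le_rfl⟩
  | insert i s hi ih =>
    intro k
    simp_rw [Finset.prod_insert hi, add_mul, one_mul, coeff_add, mul_assoc, coeff_C_mul]
    obtain ⟨m, B, hB⟩ := ih k
    rcases k with _ | k
    · simpa only [coeff_X_mul_zero, mul_zero, add_zero] using ⟨m, B, hB⟩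
    · simp_rw [coeff_X_mul]
      obtain ⟨m', B', hB'⟩ := ih k
      refine ⟨m.add ((hm i).mul m'), B + K * B', fun x => (abs_add_le _ _).trans ?_⟩
      rw [abs_mul]
      exact add_le_add (hB x) (mul_le_mul (hK i x) (hB' x) (abs_nonneg _)
        ((abs_nonneg _).trans (hK i x)))

section DeterminantalAverages

variable {μ : Measure ℝ} {n : ℕ} {P : Measure (Fin n → ℝ)} [IsProbabilityMeasure P]
  {v : Fin n → ℝ → ℝ}

open Polynomial in
/-- The averages of the elementary symmetric functions of `g (l 1), …, g (l n)` are the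
coefficients of `det (1 + X M)`, where `M` is the matrix of multiplication by `g`. -/
theorem integral_coeff_prod_eq_coeff_det
    (hv : ∀ i j, Integrable (fun x => v i x * v j x) μ) (h1 : weightedGram μ v (fun _ => 1) = 1)
    (hP : ∀ (g : ℝ → ℝ) (K : ℝ), Measurable g → (∀ x, |g x| ≤ K) →
      ∫ l, ∏ j, g (l j) ∂P = (weightedGram μ v g).det)
    {g : ℝ → ℝ} {K : ℝ} (hg : Measurable g) (hK : ∀ x, |g x| ≤ K) (k : ℕ) :
    ∫ l, (∏ j, (1 + C (g (l j)) * X)).coeff k ∂P =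
      (1 + (X : ℝ[X]) • (weightedGram μ v g).map C).det.coeff k := by
  have hmb := coeff_prod_measurable_bounded Finset.univ
    (h := fun (j : Fin n) (l : Fin n → ℝ) => g (l j)) (K := K)
    (fun j => hg.comp (measurable_pi_apply j)) fun j l => hK _
  have hint : ∀ k, Integrable (fun l : Fin n → ℝ => (∏ j, (1 + C (g (l j)) * X)).coeff k) P :=
    fun k => by
      obtain ⟨m, B, hB⟩ := hmb k
      exact integrable_of_measurable_of_abs_le m hB
  have hdeg : ∀ l : Fin n → ℝ, (∏ j, (1 + C (g (l j)) * X)).natDegree < n + 1 := fun l => by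
    refine Nat.lt_succ_of_le ((natDegree_prod_le _ _).trans ?_)
    refine (Finset.sum_le_card_nsmul _ _ 1 fun j _ => ?_).trans (by simp)
    compute_degree
  have key : ∑ m ∈ Finset.range (n + 1),
      C (∫ l, (∏ j, (1 + C (g (l j)) * X)).coeff m ∂P) * X ^ m =
      (1 + (X : ℝ[X]) • (weightedGram μ v g).map C).det := by
    refine Polynomial.funext fun s => ?_
    have hl : ∀ l : Fin n → ℝ, ∏ j, (1 + s * g (l j)) =
        ∑ m ∈ Finset.range (n + 1), (∏ j, (1 + C (g (l j)) * X)).coeff m * s ^ m := fun l => by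
      rw [← eval_eq_sum_range' (hdeg l), eval_prod]
      exact Finset.prod_congr rfl fun j _ => by
        simp only [eval_add, eval_one, eval_mul, eval_C, eval_X, mul_comm s]
    have hb : ∀ x, |1 + s * g x| ≤ 1 + |s| * K := fun x => by
      refine (abs_add_le _ _).trans ?_
      rw [abs_one, abs_mul]
      gcongr
      exact hK x
    have hdet := hP (fun x => 1 + s * g x) _ (by fun_prop) hb
    have hgram : weightedGram μ v (fun x => 1 + s * g x) = 1 + s • weightedGram μ v g := by
      rw [← h1]
      ext i j
      simp only [weightedGram, Matrix.of_apply, Matrix.add_apply, Matrix.smul_apply, smul_eq_mul,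
        add_mul, one_mul, mul_assoc]
      rw [integral_add (hv i j) ((Integrable.mul_of_abs_le hg hK (hv i j)).const_mul s),
        integral_const_mul]
    simp_rw [hl] at hdet
    rw [integral_finsetSum _ fun m _ => (hint m).mul_const _, hgram] at hdet
    simp_rw [integral_mul_const] at hdet
    rw [← coe_evalRingHom, RingHom.map_det]
    simp only [coe_evalRingHom, eval_finsetSum, eval_mul, eval_C, eval_pow, eval_X]
    rw [hdet]
    congr 1
    ext i j
    by_cases hij : i = j <;> simp [hij, mul_comm s]
  rw [← key]
  simp only [finsetSum_coeff, coeff_C_mul, coeff_X_pow, mul_ite, mul_one, mul_zero,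
    Finset.sum_ite_eq, Finset.mem_range]
  split_ifs with hk
  · rfl
  · refine integral_eq_zero_of_ae (Eventually.of_forall fun l => ?_)
    exact coeff_eq_zero_of_natDegree_lt ((hdeg l).trans_le (not_lt.1 hk))

theorem measurable_linStat {f : ℝ → ℝ} (hf : Measurable f) :
    Measurable (fun l : Fin n → ℝ => linStat f l) := by
  unfold linStat
  fun_prop

theorem abs_linStat_le {f : ℝ → ℝ} {C : ℝ} (hC : ∀ x, |f x| ≤ C) (l : Fin n → ℝ) :
    |linStat f l| ≤ n * C := by
  refine (Finset.abs_sum_le_sum_abs _ _).trans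
    ((Finset.sum_le_card_nsmul _ _ C fun j _ => hC _).trans ?_)
  simp

theorem integral_linStat_eq_trace
    (hv : ∀ i j, Integrable (fun x => v i x * v j x) μ) (h1 : weightedGram μ v (fun _ => 1) = 1)
    (hP : ∀ (g : ℝ → ℝ) (K : ℝ), Measurable g → (∀ x, |g x| ≤ K) →
      ∫ l, ∏ j, g (l j) ∂P = (weightedGram μ v g).det)
    {g : ℝ → ℝ} {K : ℝ} (hg : Measurable g) (hK : ∀ x, |g x| ≤ K) :
    ∫ l, linStat g l ∂P = (weightedGram μ v g).trace := by
  have := integral_coeff_prod_eq_coeff_det hv h1 hP hg hK 1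
  simp_rw [(coeff_prod_one_add_C_mul_X _ _).2.1] at this
  rw [Matrix.coeff_det_one_add_X_smul_one] at this
  exact this

theorem variance_linStat_eq
    (hv : ∀ i j, Integrable (fun x => v i x * v j x) μ) (h1 : weightedGram μ v (fun _ => 1) = 1)
    (hP : ∀ (g : ℝ → ℝ) (K : ℝ), Measurable g → (∀ x, |g x| ≤ K) →
      ∫ l, ∏ j, g (l j) ∂P = (weightedGram μ v g).det)
    {f : ℝ → ℝ} {C : ℝ} (hf : Measurable f) (hC : ∀ x, |f x| ≤ C)
    {b : Fin n → ℝ} (hb : weightedGram μ v f = Matrix.diagonal b) :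
    variance (fun l : Fin n → ℝ => linStat f l) P =
      ∑ i, (∫ x, f x ^ 2 * (v i x * v i x) ∂μ - b i ^ 2) := by
  have hC2 : ∀ x, |f x ^ 2| ≤ C ^ 2 := fun x => by
    rw [abs_pow]
    exact pow_le_pow_left₀ (abs_nonneg _) (hC x) 2
  have hmem : MemLp (fun l : Fin n → ℝ => linStat f l) 2 P :=
    MemLp.of_bound (measurable_linStat hf).aestronglyMeasurable _
      (Eventually.of_forall (abs_linStat_le hC))
  have hmean := integral_linStat_eq_trace hv h1 hP hf hC
  have hsq := integral_linStat_eq_trace hv h1 hP (hf.pow_const 2) hC2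
  have htwo := integral_coeff_prod_eq_coeff_det hv h1 hP hf hC 2
  have hd : (1 + (Polynomial.X : Polynomial ℝ) • (Matrix.diagonal b).map Polynomial.C).det =
      ∏ i, (1 + Polynomial.C (b i) * Polynomial.X) := by
    have : 1 + (Polynomial.X : Polynomial ℝ) • (Matrix.diagonal b).map Polynomial.C =
        Matrix.diagonal fun i => 1 + Polynomial.C (b i) * Polynomial.X := by
      ext1 i j
      by_cases hij : i = j <;> simp [hij, mul_comm Polynomial.X]
    rw [this, Matrix.det_diagonal]
  rw [hb, hd] at htwo
  have htwo' := congrArg (fun y => 2 * y) htwo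
  simp only [← integral_const_mul, (coeff_prod_one_add_C_mul_X _ _).2.2] at htwo'
  have hX2 : Integrable (fun l : Fin n → ℝ => linStat f l ^ 2) P := hmem.integrable_sq
  have hXf : Integrable (fun l : Fin n → ℝ => linStat (fun x => f x ^ 2) l) P :=
    integrable_of_measurable_of_abs_le (measurable_linStat (hf.pow_const 2)) (abs_linStat_le hC2)
  have hsub : ∫ l, linStat f l ^ 2 - linStat (fun x => f x ^ 2) l ∂P =
      (∑ i, b i) ^ 2 - ∑ i, b i ^ 2 := htwo'
  rw [integral_sub hX2 hXf, hsq] at hsub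
  rw [hb, Matrix.trace_diagonal] at hmean
  rw [variance_eq_sub hmem, hmean, Finset.sum_sub_distrib]
  have htr : (weightedGram μ v fun x => f x ^ 2).trace =
      ∑ i, ∫ x, f x ^ 2 * (v i x * v i x) ∂μ := rfl
  rw [htr] at hsub
  simp only [Pi.pow_apply]
  linarith

/-- Sub-Gaussian bound for the moment generating function of a centred linear statistic. -/
theorem mgf_linStat_sub_integral_le
    (hv : ∀ i j, Integrable (fun x => v i x * v j x) μ) (h1 : weightedGram μ v (fun _ => 1) = 1)
    (hP : ∀ (g : ℝ → ℝ) (K : ℝ), Measurable g → (∀ x, |g x| ≤ K) →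
      ∫ l, ∏ j, g (l j) ∂P = (weightedGram μ v g).det)
    {f : ℝ → ℝ} {C : ℝ} (hf : Measurable f) (hC : ∀ x, |f x| ≤ C)
    {b : Fin n → ℝ} (hb : weightedGram μ v f = Matrix.diagonal b) {t : ℝ} (ht : |t| * C ≤ 1 / 2) :
    mgf (fun l => linStat f l - ∫ l, linStat f l ∂P) P t ≤
      Real.exp (t ^ 2 * variance (fun l : Fin n → ℝ => linStat f l) P) := by
  have hnorm : ∀ i, ∫ x, v i x * v i x ∂μ = 1 := fun i => by
    have := congrFun (congrFun h1 i) i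
    simpa [weightedGram] using this
  have hbi : ∀ i, ∫ x, f x * (v i x * v i x) ∂μ = b i := fun i => by
    have := congrFun (congrFun hb i) i
    simpa [weightedGram] using this
  have hfi : ∀ i, Integrable (fun x => f x * (v i x * v i x)) μ := fun i =>
    Integrable.mul_of_abs_le hf hC (hv i i)
  have hC2 : ∀ x, |f x ^ 2| ≤ C ^ 2 := fun x => by
    rw [abs_pow]
    exact pow_le_pow_left₀ (abs_nonneg _) (hC x) 2
  have hf2i : ∀ i, Integrable (fun x => f x ^ 2 * (v i x * v i x)) μ := fun i =>
    Integrable.mul_of_abs_le (hf.pow_const 2) hC2 (hv i i)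
  have hbC : ∀ i, |b i| ≤ C := fun i => by
    rw [← hbi i]
    refine (abs_integral_le_integral_abs).trans ?_
    calc ∫ x, |f x * (v i x * v i x)| ∂μ ≤ ∫ x, C * (v i x * v i x) ∂μ := by
          refine integral_mono (hfi i).abs ((hv i i).const_mul C) fun x => ?_
          simp only [abs_mul, abs_mul_abs_self]
          exact mul_le_mul_of_nonneg_right (hC x) (mul_self_nonneg _)
      _ = C := by rw [integral_const_mul, hnorm, mul_one]
  let g : ℝ → ℝ := fun x => Real.exp (t * f x)
  have hg : Measurable g := by fun_prop
  have htf : ∀ x, |t * f x| ≤ 1 / 2 := fun x => by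
    rw [abs_mul]
    exact (mul_le_mul_of_nonneg_left (hC x) (abs_nonneg t)).trans ht
  have htb : ∀ i, |t * b i| ≤ 1 / 2 := fun i => by
    rw [abs_mul]
    exact (mul_le_mul_of_nonneg_left (hbC i) (abs_nonneg t)).trans ht
  have hgK : ∀ x, |g x| ≤ Real.exp (1 / 2) := fun x => by
    rw [Real.abs_exp]
    exact Real.exp_le_exp.2 ((le_abs_self _).trans (htf x))
  have hgi : ∀ i j, Integrable (fun x => g x * (v i x * v j x)) μ := fun i j =>
    Integrable.mul_of_abs_le hg hgK (hv i j)
  have hmean : ∫ l, linStat f l ∂P = ∑ i, b i := by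
    rw [integral_linStat_eq_trace hv h1 hP hf hC, hb, Matrix.trace_diagonal]
  let D : Matrix (Fin n) (Fin n) ℝ := Matrix.diagonal fun i => Real.exp (-(t * b i) / 2)
  have hN : (D * weightedGram μ v g * D.conjTranspose).PosSemidef :=
    (posSemidef_weightedGram (fun x => (Real.exp_pos _).le) hgi).mul_mul_conjTranspose_same D
  have hD : D.conjTranspose = D := by simp [D]
  have hexp : ∀ i, Real.exp (-(t * b i) / 2) * Real.exp (-(t * b i) / 2) =
      Real.exp (-(t * b i)) := fun i => by
    rw [← Real.exp_add]
    congr 1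
    ring
  have hdet : (D * weightedGram μ v g * D.conjTranspose).det =
      Real.exp (-(t * ∑ i, b i)) * (weightedGram μ v g).det := by
    have hDD : D.det * D.det = Real.exp (-(t * ∑ i, b i)) := by
      simp only [D]
      rw [Matrix.det_diagonal, ← Finset.prod_mul_distrib, Finset.prod_congr rfl fun i _ => hexp i,
        ← Real.exp_sum, Finset.sum_neg_distrib, Finset.mul_sum]
    rw [hD, Matrix.det_mul, Matrix.det_mul, ← hDD]
    ring
  have hmgf : mgf (fun l => linStat f l - ∫ l, linStat f l ∂P) P t =
      (D * weightedGram μ v g * D.conjTranspose).det := by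
    rw [hdet, ← hP g _ hg hgK, mgf, ← integral_const_mul]
    congr 1
    funext l
    rw [hmean, ← Real.exp_sum, ← Real.exp_add, ← Finset.mul_sum]
    simp only [linStat]
    congr 1
    ring
  rw [hmgf]
  refine hN.det_le_exp_trace_sub_card.trans (Real.exp_le_exp.2 ?_)
  have htr : (D * weightedGram μ v g * D.conjTranspose).trace =
      ∑ i, ∫ x, Real.exp (-(t * b i)) * (g x * (v i x * v i x)) ∂μ := by
    rw [hD]
    simp only [Matrix.trace, D, Matrix.diag_apply, Matrix.mul_diagonal, Matrix.diagonal_mul]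
    refine Finset.sum_congr rfl fun i _ => ?_
    rw [integral_const_mul, ← hexp i, weightedGram, Matrix.of_apply]
    ring
  rw [htr, variance_linStat_eq hv h1 hP hf hC hb, Finset.mul_sum, sub_le_iff_le_add]
  have hterm : ∀ i, ∫ x, Real.exp (-(t * b i)) * (g x * (v i x * v i x)) ∂μ ≤
      t ^ 2 * (∫ x, f x ^ 2 * (v i x * v i x) ∂μ - b i ^ 2) + 1 := fun i => by
    have hpt : ∀ x, Real.exp (-(t * b i)) * (g x * (v i x * v i x)) ≤
        ((1 - t * b i + t ^ 2 * b i ^ 2) * (v i x * v i x) +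
          (t - 2 * t ^ 2 * b i) * (f x * (v i x * v i x))) +
          t ^ 2 * (f x ^ 2 * (v i x * v i x)) := fun x => by
      have hu : |t * f x - t * b i| ≤ 1 :=
        (abs_sub _ _).trans (by linarith [htf x, htb i])
      have he := (abs_le.1 (Real.abs_exp_sub_one_sub_id_le hu)).2
      have : Real.exp (-(t * b i)) * (g x * (v i x * v i x)) =
          Real.exp (t * f x - t * b i) * (v i x * v i x) := by
        rw [← mul_assoc, ← Real.exp_add]
        congr 2
        ring
      rw [this]
      nlinarith [mul_le_mul_of_nonneg_right he (mul_self_nonneg (v i x))]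
    have hlin : Integrable (fun x => (1 - t * b i + t ^ 2 * b i ^ 2) * (v i x * v i x) +
        (t - 2 * t ^ 2 * b i) * (f x * (v i x * v i x))) μ :=
      ((hv i i).const_mul _).add ((hfi i).const_mul _)
    refine (integral_mono ((hgi i i).const_mul _)
      (hlin.add ((hf2i i).const_mul _)) hpt).trans ?_
    simp only [Pi.add_apply]
    rw [integral_add hlin ((hf2i i).const_mul _),
      integral_add ((hv i i).const_mul _) ((hfi i).const_mul _)]
    simp only [integral_const_mul, hnorm, hbi]
    nlinarith
  refine (Finset.sum_le_sum fun i _ => hterm i).trans ?_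
  simp [Finset.sum_add_distrib]

end DeterminantalAverages

/-- Two-sided Chernoff bound from a bound on the moment generating function at `±t`. -/
theorem measure_abs_ge_le_of_mgf_le {α : Type*} [MeasurableSpace α] {P : Measure α}
    [IsProbabilityMeasure P] {Y : α → ℝ} {K t ε B : ℝ} (hY : Measurable Y) (hK : ∀ x, |Y x| ≤ K)
    (ht : 0 ≤ t) (hpos : mgf Y P t ≤ Real.exp B) (hneg : mgf Y P (-t) ≤ Real.exp B) :
    P {x | ε ≤ |Y x|} ≤ ENNReal.ofReal (2 * Real.exp (B - t * ε)) := by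
  have hint : ∀ s : ℝ, Integrable (fun x => Real.exp (s * Y x)) P := fun s => by
    refine integrable_of_measurable_of_abs_le (K := Real.exp (|s| * K)) (by fun_prop) fun x => ?_
    rw [Real.abs_exp, Real.exp_le_exp]
    refine (le_abs_self _).trans ?_
    rw [abs_mul]
    exact mul_le_mul_of_nonneg_left (hK x) (abs_nonneg s)
  have hsub : {x | ε ≤ |Y x|} ⊆ {x | ε ≤ Y x} ∪ {x | Y x ≤ -ε} := fun x hx => by
    rcases le_abs.1 (show ε ≤ |Y x| from hx) with h | h
    · exact Or.inl h
    · exact Or.inr (show Y x ≤ -ε by linarith)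
  have hup := measure_ge_le_exp_mul_mgf ε ht (hint t)
  have hlo := measure_le_le_exp_mul_mgf (-ε) (neg_nonpos.2 ht) (hint (-t))
  have e : Real.exp (-t * ε) * Real.exp B = Real.exp (B - t * ε) := by
    rw [← Real.exp_add]
    congr 1
    ring
  rw [← ofReal_measureReal]
  refine ENNReal.ofReal_le_ofReal ?_
  refine (measureReal_mono hsub).trans ((measureReal_union_le _ _).trans ?_)
  have h1 := mul_le_mul_of_nonneg_left hpos (Real.exp_pos (-t * ε)).le
  have h2 := mul_le_mul_of_nonneg_left hneg (Real.exp_pos (-t * ε)).le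
  rw [neg_neg, mul_neg, ← neg_mul] at hlo
  linarith

theorem abs_le_supNorm {f : ℝ → ℝ} (h : ∃ C, ∀ x, |f x| ≤ C) (x : ℝ) : |f x| ≤ supNorm f := by
  obtain ⟨C, hC⟩ := h
  exact le_ciSup (f := fun x => |f x|) ⟨C, by rintro _ ⟨y, rfl⟩; exact hC y⟩ x


/-- **General concentration inequality for OPEs** (Theorem 3.1 applied to OPEs): there is
a universal constant `A > 0` such that for every probability measure `μ` on `ℝ` with
infinite support and all moments finite, every bounded measurable `f`, every `n` and
every `ε > 0`:
`P(|X_f - E X_f| ≥ ε) ≤ 2 exp(-ε²/(4A Var X_f))` if `ε < 2A Var X_f/(3‖f‖_∞)`, and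
`P(|X_f - E X_f| ≥ ε) ≤ 2 exp(-ε/(6‖f‖_∞))` if `ε ≥ 2A Var X_f/(3‖f‖_∞)`. -/
theorem general_concentration :
    ∃ A : ℝ, 0 < A ∧
      ∀ (μ : Measure ℝ), IsProbabilityMeasure μ → InfiniteSupport μ → HasAllMoments μ →
        ∀ f : ℝ → ℝ, Measurable f → (∃ C : ℝ, ∀ x, |f x| ≤ C) →
          ∀ n : ℕ, ∀ ε : ℝ, 0 < ε →
            (ε < 2 * A * variance (fun l : Fin n → ℝ => linStat f l) (OPE μ n) /
                (3 * supNorm f) →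
              (OPE μ n) {l | ε ≤ |linStat f l - ∫ l, linStat f l ∂(OPE μ n)|} ≤
                ENNReal.ofReal (2 * Real.exp (-(ε ^ 2 /
                  (4 * A * variance (fun l : Fin n → ℝ => linStat f l) (OPE μ n)))))) ∧
            (2 * A * variance (fun l : Fin n → ℝ => linStat f l) (OPE μ n) /
                (3 * supNorm f) ≤ ε →
              (OPE μ n) {l | ε ≤ |linStat f l - ∫ l, linStat f l ∂(OPE μ n)|} ≤
                ENNReal.ofReal (2 * Real.exp (-(ε / (6 * supNorm f))))) := by
  refine ⟨1, one_pos, fun μ _ hinf hmom f hf hbdd n ε hε => ?_⟩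
  have hM := abs_le_supNorm hbdd
  have := isProbabilityMeasure_OPE hinf hmom n
  obtain ⟨v, b, hv, h1, hb, hP⟩ := exists_diagonalizing_family hinf hmom hf hM n
  set M := supNorm f
  set V := variance (fun l : Fin n → ℝ => linStat f l) (OPE μ n)
  have hM0 : 0 ≤ M := (abs_nonneg _).trans (hM 0)
  have hV0 : 0 ≤ V := variance_nonneg _ _
  have chernoff : ∀ t, 0 ≤ t → t * M ≤ 1 / 2 →
      (OPE μ n) {l | ε ≤ |linStat f l - ∫ l, linStat f l ∂(OPE μ n)|} ≤
        ENNReal.ofReal (2 * Real.exp (t ^ 2 * V - t * ε)) := fun t ht htM => by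
    refine measure_abs_ge_le_of_mgf_le (K := n * M + |∫ l, linStat f l ∂(OPE μ n)|)
      ((measurable_linStat hf).sub_const _) (fun l => ?_) ht ?_ ?_
    · exact (abs_sub _ _).trans (by gcongr; exact abs_linStat_le hM l)
    · exact mgf_linStat_sub_integral_le hv h1 hP hf hM hb (by rwa [abs_of_nonneg ht])
    · have := mgf_linStat_sub_integral_le hv h1 hP hf hM hb (t := -t)
        (by rwa [abs_neg, abs_of_nonneg ht])
      rwa [neg_sq] at this
  refine ⟨fun hlt => ?_, fun hge => ?_⟩
  · have hMpos : 0 < M := hM0.lt_of_ne fun h => by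
      rw [← h] at hlt
      simp at hlt
      linarith
    rw [lt_div_iff₀ (by positivity)] at hlt
    have hVpos : 0 < V := by nlinarith [mul_pos hε hMpos]
    refine (chernoff (ε / (2 * V)) (by positivity) ?_).trans (le_of_eq ?_)
    · rw [div_mul_eq_mul_div, div_le_iff₀ (by positivity)]
      linarith
    · congr 3
      field_simp
      ring
  · rcases hM0.eq_or_lt with h | hMpos
    · refine prob_le_one.trans ?_
      rw [← h]
      simp
    · rw [div_le_iff₀ (by positivity)] at hge
      refine (chernoff (1 / (3 * M)) (by positivity) ?_).trans (ENNReal.ofReal_le_ofReal ?_)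
      · field_simp
        norm_num
      · gcongr
        have e : (1 / (3 * M)) ^ 2 * V - 1 / (3 * M) * ε - -(ε / (6 * M)) =
            (2 * 1 * V - ε * (3 * M)) / (18 * M ^ 2) := by
          field_simp
          ring
        have : (2 * 1 * V - ε * (3 * M)) / (18 * M ^ 2) ≤ 0 :=
          div_nonpos_of_nonpos_of_nonneg (by linarith) (by positivity)
        linarith
end
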